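/- Let n ≥ 2, let ξ = e^{2πi/6}, and let Λ = ℤ[ξ](ξe_1 − e_2) + Σ_{j=2}^{n} ℤ[ξ](e_{j-1} − e_j) ⊆ ℂⁿ (a G(6,1,n)-invariant ℤ-lattice of full rank 2n). Then for p = 2 and for p = 3, the affine reflection group W = G(6,p,n) ⋉ Λ has the Steinberg property, except in the single case p = 3, n = 2 is NOT excluded here (the group [G(6,3,2)]₁ with this lattice does have the property): every point of ℂⁿ fixed by some non-identity element of W lies on a reflecting hyperplane of W. -/

import Mathlib

open Matrix Complex

noncomputable section

/-- `ℤ[ζ] = ℤ + ℤζ` as a subset of `ℂ`. -/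
def Zlat (ζ : ℂ) : Set ℂ := {z | ∃ a b : ℤ, z = (a : ℂ) + (b : ℂ) * ζ}

/-- Membership in the complex reflection group `G(r,p,n)`: monomial matrices whose
nonzero entries are `r`-th roots of unity and whose product of nonzero entries,
raised to the power `r / p`, equals `1`. -/
def IsGrpn (r p n : ℕ) (M : Matrix (Fin n) (Fin n) ℂ) : Prop :=
  (∀ i, ∃! j, M i j ≠ 0) ∧ (∀ j, ∃! i, M i j ≠ 0) ∧
  (∀ i j, M i j ≠ 0 → M i j ^ r = 1) ∧
  (∏ i, ∑ j, M i j) ^ (r / p) = 1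

/-- The affine transformation `v ↦ M v + t` encoded by the pair `g = (M, t)`. -/
def applyAff {n : ℕ} (g : Matrix (Fin n) (Fin n) ℂ × (Fin n → ℂ)) (v : Fin n → ℂ) :
    Fin n → ℂ :=
  g.1.mulVec v + g.2

/-- An affine hyperplane in `ℂⁿ`: the solution set of a nonzero affine-linear equation. -/
def IsAffineHyperplane {n : ℕ} (H : Set (Fin n → ℂ)) : Prop :=
  ∃ a : Fin n → ℂ, a ≠ 0 ∧ ∃ c : ℂ, H = {v | ∑ i, a i * v i = c}

/-- A reflecting hyperplane of `W`: an affine hyperplane fixed pointwise by some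
non-identity element of `W`. -/
def IsReflectingHyperplane {n : ℕ}
    (W : Matrix (Fin n) (Fin n) ℂ × (Fin n → ℂ) → Prop) (H : Set (Fin n → ℂ)) : Prop :=
  IsAffineHyperplane H ∧
  ∃ g, W g ∧ (∃ v, applyAff g v ≠ v) ∧ ∀ v ∈ H, applyAff g v = v

/-- `W` has the Steinberg property: every point fixed by some non-identity element
of `W` lies on a reflecting hyperplane of `W`. -/
def SteinbergProperty {n : ℕ}
    (W : Matrix (Fin n) (Fin n) ℂ × (Fin n → ℂ) → Prop) : Prop :=
  ∀ u : Fin n → ℂ,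
    (∃ g, W g ∧ (∃ v, applyAff g v ≠ v) ∧ applyAff g u = u) →
    ∃ H, IsReflectingHyperplane W H ∧ u ∈ H

/-- `stdGen n 0 = e₁` and, for `j ≥ 1` (0-indexed), `stdGen n j = e_{j-1} - e_j`. -/
def stdGen (n : ℕ) (j : Fin n) : Fin n → ℂ := fun i =>
  if i = j then (if (j : ℕ) = 0 then 1 else -1)
  else if (i : ℕ) + 1 = (j : ℕ) then 1 else 0

/-- `genB n ξ 0 = ξ e₁ - e₂` and, for `j ≥ 1` (0-indexed), `genB n ξ j = e_{j-1} - e_j`. -/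
def genB (n : ℕ) (ξ : ℂ) (j : Fin n) : Fin n → ℂ :=
  if (j : ℕ) = 0 then
    (fun i => if (i : ℕ) = 0 then ξ else if (i : ℕ) = 1 then -1 else 0)
  else stdGen n j

/-- The ring `ℤ[ξ]` of Eisenstein integers, for `ξ` a root of `X² - X + 1`. -/
def eisensteinSubring (ξ : ℂ) (h : ξ ^ 2 = ξ - 1) : Subring ℂ where
  carrier := Zlat ξ
  mul_mem' := by
    rintro _ _ ⟨a, b, rfl⟩ ⟨c, d, rfl⟩
    refine ⟨a * c - b * d, a * d + b * c + b * d, ?_⟩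
    push_cast
    linear_combination (b * d : ℂ) * h
  one_mem' := ⟨1, 0, by simp⟩
  add_mem' := by
    rintro _ _ ⟨a, b, rfl⟩ ⟨c, d, rfl⟩
    exact ⟨a + c, b + d, by push_cast; ring⟩
  zero_mem' := ⟨0, 0, by simp⟩
  neg_mem' := by
    rintro _ ⟨a, b, rfl⟩
    exact ⟨-a, -b, by push_cast; ring⟩

theorem exp_two_pi_I_div_six_sq {ξ : ℂ} (hξ : ξ = Complex.exp (2 * Real.pi * Complex.I / 6)) :
    ξ ^ 2 = ξ - 1 := by
  have hp : IsPrimitiveRoot ξ 6 := by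
    rw [hξ]
    exact_mod_cast Complex.isPrimitiveRoot_exp 6 (by norm_num)
  have h6 : ξ ^ 6 = 1 := hp.pow_eq_one
  have h3 : ξ ^ 3 ≠ 1 := hp.pow_ne_one_of_pos_of_lt (by norm_num) (by norm_num)
  have h2 : ξ ^ 2 ≠ 1 := hp.pow_ne_one_of_pos_of_lt (by norm_num) (by norm_num)
  have h1 : ξ + 1 ≠ 0 := fun h => h2 (by linear_combination (ξ - 1) * h)
  have : (ξ ^ 3 - 1) * ((ξ + 1) * (ξ ^ 2 - ξ + 1)) = 0 := by linear_combination h6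
  have := (mul_eq_zero.1 this).resolve_left (sub_ne_zero.2 h3)
  linear_combination (mul_eq_zero.1 this).resolve_left h1

/-- A sixth root of unity has order `1`, `2`, `3` or `6`. -/
theorem sixth_root_cases {ζ : ℂ} (hζ : ζ ^ 6 = 1) :
    ζ = 1 ∨ ζ = -1 ∨ ζ ^ 2 + ζ + 1 = 0 ∨ ζ ^ 2 - ζ + 1 = 0 := by
  have : (ζ - 1) * ((ζ + 1) * ((ζ ^ 2 + ζ + 1) * (ζ ^ 2 - ζ + 1))) = 0 := by
    linear_combination hζ
  simpa only [mul_eq_zero, sub_eq_zero (b := (1 : ℂ)), add_eq_zero_iff_eq_neg (b := (1 : ℂ))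
    (a := ζ)] using this

section Eisenstein

variable {ξ : ℂ} {h : ξ ^ 2 = ξ - 1}

theorem generator_mem : ξ ∈ eisensteinSubring ξ h := ⟨0, 1, by simp⟩

theorem sixth_root_mem {ζ : ℂ} (hζ : ζ ^ 6 = 1) : ζ ∈ eisensteinSubring ξ h := by
  have hξ : ξ ∈ eisensteinSubring ξ h := generator_mem
  have h1 := one_mem (eisensteinSubring ξ h)
  rcases sixth_root_cases hζ with rfl | rfl | h3 | h6
  · exact h1
  · exact neg_mem h1
  · have : (ζ + ξ) * (ζ - (ξ - 1)) = 0 := by linear_combination h3 - h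
    rcases mul_eq_zero.1 this with h' | h'
    · rw [eq_neg_of_add_eq_zero_left h']
      exact neg_mem hξ
    · rw [sub_eq_zero.1 h']
      exact sub_mem hξ h1
  · have : (ζ - ξ) * (ζ - (1 - ξ)) = 0 := by linear_combination h6 - h
    rcases mul_eq_zero.1 this with h' | h'
    · rwa [sub_eq_zero.1 h']
    · rw [sub_eq_zero.1 h']
      exact sub_mem h1 hξ

/-- `1 - ζ` is a unit of `ℤ[ξ]` when `ζ` is a primitive sixth root of unity. -/
theorem mem_of_one_sub_mul_mem {ζ x : ℂ} (h6 : ζ ^ 2 - ζ + 1 = 0)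
    (hx : (1 - ζ) * x ∈ eisensteinSubring ξ h) : x ∈ eisensteinSubring ξ h := by
  have hζ : ζ ^ 6 = 1 := by
    linear_combination (ζ ^ 4 + ζ ^ 3 - ζ - 1) * h6
  have := mul_mem (sixth_root_mem (h := h) hζ) hx
  rwa [show ζ * ((1 - ζ) * x) = x by linear_combination -x * h6] at this

/-- The nonzero classes of `ℤ[ξ] / 2 ≅ 𝔽₄` are permuted transitively by the cube roots of unity. -/
theorem half_mem_or_exists_sub_mul_mem {x y : ℂ} (hx : 2 * x ∈ eisensteinSubring ξ h)
    (hy : 2 * y ∈ eisensteinSubring ξ h) :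
    x ∈ eisensteinSubring ξ h ∨ y ∈ eisensteinSubring ξ h ∨
      ∃ ζ : ℂ, ζ ^ 6 = 1 ∧ x - ζ * y ∈ eisensteinSubring ξ h := by
  obtain ⟨a, b, hab⟩ := hx
  obtain ⟨c, d, hcd⟩ := hy
  have h6 : ξ ^ 6 = 1 := by linear_combination (ξ ^ 4 + ξ ^ 3 - ξ - 1) * h
  have key : (2 ∣ a ∧ 2 ∣ b) ∨ (2 ∣ c ∧ 2 ∣ d) ∨ (2 ∣ a - c ∧ 2 ∣ b - d) ∨
      (2 ∣ a + d ∧ 2 ∣ b - (c + d)) ∨ (2 ∣ a + (c + d) ∧ 2 ∣ b - c) := by omega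
  rcases key with ⟨⟨k, hk⟩, l, hl⟩ | ⟨⟨k, hk⟩, l, hl⟩ | ⟨⟨k, hk⟩, l, hl⟩ | ⟨⟨k, hk⟩, l, hl⟩ |
    ⟨⟨k, hk⟩, l, hl⟩ <;> apply_fun ((↑) : ℤ → ℂ) at hk hl <;> push_cast at hk hl
  · exact .inl ⟨k, l, by linear_combination hab / 2 + hk / 2 + ξ * hl / 2⟩
  · exact .inr (.inl ⟨k, l, by linear_combination hcd / 2 + hk / 2 + ξ * hl / 2⟩)
  · exact .inr (.inr ⟨1, by simp, k, l, by
      linear_combination hab / 2 - hcd / 2 + hk / 2 + ξ * hl / 2⟩)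
  · exact .inr (.inr ⟨ξ, h6, k, l, by
      linear_combination hab / 2 - ξ * hcd / 2 + hk / 2 + ξ * hl / 2 - d / 2 * h⟩)
  · exact .inr (.inr ⟨ξ ^ 2, by linear_combination (ξ ^ 6 + 1) * h6, k, l, by
      linear_combination hab / 2 - ξ ^ 2 * hcd / 2 + hk / 2 + ξ * hl / 2
        - (c + d + d * ξ) / 2 * h⟩)

/-- The nonzero classes of `ℤ[ξ] / (1 + ξ) ≅ 𝔽₃` are swapped by `-1`. -/
theorem third_mem_or_exists_sub_mul_mem {x y : ℂ} (hx : (1 + ξ) * x ∈ eisensteinSubring ξ h)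
    (hy : (1 + ξ) * y ∈ eisensteinSubring ξ h) :
    x ∈ eisensteinSubring ξ h ∨ y ∈ eisensteinSubring ξ h ∨
      ∃ ζ : ℂ, ζ ^ 6 = 1 ∧ x - ζ * y ∈ eisensteinSubring ξ h := by
  have h0 : (1 + ξ) ≠ 0 := fun h' => by
    have : (3 : ℂ) = 0 := by linear_combination (2 - ξ) * h' + h
    norm_num at this
  have div {z : ℂ} {a b : ℤ} (hz : (1 + ξ) * z = a + b * ξ) (hd : 3 ∣ a - b) :
      z ∈ eisensteinSubring ξ h := by
    obtain ⟨k, hk⟩ := hd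
    apply_fun ((↑) : ℤ → ℂ) at hk
    push_cast at hk
    refine ⟨b + 2 * k, -k, mul_left_cancel₀ h0 ?_⟩
    push_cast
    linear_combination hz + hk + k * h
  obtain ⟨a, b, hab⟩ := hx
  obtain ⟨c, d, hcd⟩ := hy
  have key : 3 ∣ a - b ∨ 3 ∣ c - d ∨ 3 ∣ (a - c) - (b - d) ∨ 3 ∣ (a + c) - (b + d) := by
    have h1 : (a - b) % 3 = 0 ∨ (a - b) % 3 = 1 ∨ (a - b) % 3 = 2 := by omega
    have h2 : (c - d) % 3 = 0 ∨ (c - d) % 3 = 1 ∨ (c - d) % 3 = 2 := by omega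
    rcases h1 with h1 | h1 | h1 <;> rcases h2 with h2 | h2 | h2 <;> omega
  rcases key with hk | hk | hk | hk
  · exact .inl (div hab hk)
  · exact .inr (.inl (div hcd hk))
  · exact .inr (.inr ⟨1, by simp, div (by push_cast; linear_combination hab - hcd) hk⟩)
  · exact .inr (.inr ⟨-1, by norm_num, div (by push_cast; linear_combination hab + hcd) hk⟩)

/-- If `ζ` is a primitive cube root of unity then `1 - ζ` and `1 + ξ` are associated. -/
theorem one_add_mul_mem {ζ x : ℂ} (h3 : ζ ^ 2 + ζ + 1 = 0)
    (hx : (1 - ζ) * x ∈ eisensteinSubring ξ h) : (1 + ξ) * x ∈ eisensteinSubring ξ h := by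
  have : (ζ + ξ) * (ζ - (ξ - 1)) = 0 := by linear_combination h3 - h
  rcases mul_eq_zero.1 this with h' | h'
  · rwa [show (1 + ξ) * x = (1 - ζ) * x by linear_combination x * h']
  · have := mul_mem (generator_mem (h := h)) hx
    rwa [show ξ * ((1 - ζ) * x) = (1 + ξ) * x by linear_combination -x * ξ * h' - x * h] at this

theorem genB_apply_mem {n : ℕ} (i j : Fin n) : genB n ξ j i ∈ eisensteinSubring ξ h := by
  have h0 := zero_mem (eisensteinSubring ξ h)
  have h1 := one_mem (eisensteinSubring ξ h)
  have hξ := generator_mem (h := h)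
  unfold genB stdGen
  split_ifs <;> dsimp only <;> split_ifs <;> first | assumption | exact neg_mem h1

/-- The lattice generated by the vectors `genB` is `ℤ[ξ]ⁿ`. -/
theorem genB_lattice_eq {n : ℕ} (hn : 2 ≤ n) :
    {v : Fin n → ℂ | ∃ c : Fin n → ℂ, (∀ j, c j ∈ Zlat ξ) ∧ v = ∑ j, c j • genB n ξ j} =
      {v | ∀ i, v i ∈ eisensteinSubring ξ h} := by
  ext v
  constructor
  · rintro ⟨c, hc, rfl⟩ i
    rw [Finset.sum_apply]
    exact sum_mem fun j _ => mul_mem (hc j) (genB_apply_mem i j)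
  · intro hv
    set S := Submodule.span (eisensteinSubring ξ h) (Set.range (genB n ξ))
    have hgen (j : Fin n) : genB n ξ j ∈ S := Submodule.subset_span ⟨j, rfl⟩
    have hsingle (k : ℕ) : ∀ hk : k < n, Pi.single (⟨k, hk⟩ : Fin n) (1 : ℂ) ∈ S := by
      induction k with
      | zero =>
        intro hk
        have := S.smul_mem (⟨-ξ, neg_mem generator_mem⟩ : eisensteinSubring ξ h)
          (sub_mem (hgen ⟨0, hk⟩) (hgen ⟨1, hn⟩))
        convert this using 1
        ext i
        have hξ : 1 = -(ξ * (ξ - 1)) := by linear_combination (1 + ξ) * h - ξ * h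
        obtain ⟨_ | _ | i, hi⟩ := i <;>
          simp [genB, stdGen, Subring.smul_def]
        exact hξ
      | succ k ih =>
        intro hk
        convert sub_mem (ih (by omega)) (hgen ⟨k + 1, hk⟩) using 1
        ext i
        have hg : genB n ξ ⟨k + 1, hk⟩ = stdGen n ⟨k + 1, hk⟩ := by simp [genB]
        simp only [hg, stdGen, Pi.single_apply, Fin.ext_iff, Pi.sub_apply]
        split_ifs <;> first | omega | contradiction | simp
    have hvS : v ∈ S := by
      rw [← Finset.univ_sum_single v]
      refine sum_mem fun i _ => ?_
      convert S.smul_mem (⟨v i, hv i⟩ : eisensteinSubring ξ h) (hsingle i i.2) using 1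
      ext j
      simp [Pi.single_apply, Subring.smul_def]
    obtain ⟨c, rfl⟩ := Submodule.mem_span_range_iff_exists_fun _ |>.1 hvS
    exact ⟨fun j => c j, fun j => (c j).2, rfl⟩

end Eisenstein

section Monomial

variable {n : ℕ}

/-- The monomial matrix sending `v` to `i ↦ d i * v (σ i)`. -/
def monomialMatrix (σ : Equiv.Perm (Fin n)) (d : Fin n → ℂ) : Matrix (Fin n) (Fin n) ℂ :=
  Matrix.of fun i j => if j = σ i then d i else 0

theorem monomialMatrix_mulVec (σ : Equiv.Perm (Fin n)) (d v : Fin n → ℂ) (i : Fin n) :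
    (monomialMatrix σ d *ᵥ v) i = d i * v (σ i) := by
  simp [monomialMatrix, Matrix.mulVec, dotProduct]

theorem isGrpn_monomialMatrix {r p : ℕ} (hr : r ≠ 0) (σ : Equiv.Perm (Fin n)) {d : Fin n → ℂ}
    (hd : ∀ i, d i ^ r = 1) (hprod : (∏ i, d i) ^ (r / p) = 1) :
    IsGrpn r p n (monomialMatrix σ d) := by
  have h0 (i) : d i ≠ 0 := fun h => by simpa [h, hr] using hd i
  refine ⟨fun i => ⟨σ i, ?_, ?_⟩, fun j => ⟨σ.symm j, ?_, ?_⟩, fun i j hij => ?_, ?_⟩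
  · simp [monomialMatrix, h0]
  · simp +contextual [monomialMatrix]
  · simp [monomialMatrix, h0]
  · simp +contextual [monomialMatrix]
  · have : j = σ i := by by_contra hne; simp [monomialMatrix, hne] at hij
    simp [monomialMatrix, this, hd]
  · simpa [monomialMatrix] using hprod

theorem applyAff_apply_of_row {M : Matrix (Fin n) (Fin n) ℂ} {i j : Fin n}
    (hM : ∀ k, k ≠ j → M i k = 0) (t v : Fin n → ℂ) :
    applyAff (M, t) v i = M i j * v j + t i := by
  simp only [applyAff, Pi.add_apply, Matrix.mulVec, dotProduct]
  rw [Finset.sum_eq_single j (fun k _ hk => by rw [hM k hk, zero_mul]) (by simp)]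

/-- If `u i - ζ * u j` lies in `R`, then `u` lies on the hyperplane of a reflection
of order two exchanging the coordinates `i` and `j`. -/
theorem exists_reflectingHyperplane_swap {r p : ℕ} (hr : r ≠ 0) {R : Subring ℂ}
    {i j : Fin n} (hij : i ≠ j) {ζ : ℂ} (hζ : ζ ^ r = 1) (hζR : ζ⁻¹ ∈ R) {u : Fin n → ℂ}
    (hu : u i - ζ * u j ∈ R) :
    ∃ H, IsReflectingHyperplane (fun g => IsGrpn r p n g.1 ∧ g.2 ∈ {v | ∀ k, v k ∈ R}) H ∧
      u ∈ H := by
  have hζ0 : ζ ≠ 0 := fun h => by simp [h, hr] at hζ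
  set c := u i - ζ * u j with hc
  set d : Fin n → ℂ := Pi.mulSingle i ζ * Pi.mulSingle j ζ⁻¹ with hd
  set t : Fin n → ℂ := Pi.single i c + Pi.single j (-(ζ⁻¹ * c)) with ht
  have hdi : d i = ζ := by simp [hd, hij]
  have hdj : d j = ζ⁻¹ := by simp [hd, hij.symm]
  have hti : t i = c := by simp [ht, hij]
  have htj : t j = -(ζ⁻¹ * c) := by simp [ht, hij.symm]
  have hdk {k} (hki : k ≠ i) (hkj : k ≠ j) : d k = 1 := by simp [hd, hki, hkj]
  have htk {k} (hki : k ≠ i) (hkj : k ≠ j) : t k = 0 := by simp [ht, hki, hkj]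
  have haff (v : Fin n → ℂ) (k : Fin n) :
      applyAff (monomialMatrix (Equiv.swap i j) d, t) v k = d k * v (Equiv.swap i j k) + t k := by
    rw [applyAff, Pi.add_apply, monomialMatrix_mulVec]
  refine ⟨{v | ∑ k, (Pi.single i 1 - Pi.single j ζ : Fin n → ℂ) k * v k = c},
    ⟨⟨_, fun h => ?_, c, rfl⟩, (monomialMatrix (Equiv.swap i j) d, t), ⟨?_, fun k => ?_⟩, ?_, ?_⟩,
    ?_⟩
  · simpa [hij] using congrFun h i
  · refine isGrpn_monomialMatrix hr _ (fun k => ?_) ?_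
    · by_cases hki : k = i
      · rw [hki, hdi, hζ]
      by_cases hkj : k = j
      · rw [hkj, hdj, inv_pow, hζ, inv_one]
      rw [hdk hki hkj, one_pow]
    · simp [hd, Finset.prod_mul_distrib, hζ0]
  · by_cases hki : k = i
    · simpa only [hki, hti] using hu
    by_cases hkj : k = j
    · simpa only [hkj, htj] using neg_mem (mul_mem hζR hu)
    simpa only [htk hki hkj] using zero_mem R
  · refine ⟨Pi.single i (c + 1), fun h => ?_⟩
    have := congrFun h i
    simp [haff, hti, hij.symm] at this
  · intro v hv
    have hv' : v i - ζ * v j = c := by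
      simpa [sub_mul, Finset.sum_sub_distrib, Pi.single_apply] using hv
    ext k
    rw [haff]
    by_cases hki : k = i
    · rw [hki, Equiv.swap_apply_left, hdi, hti, ← hv']
      ring
    by_cases hkj : k = j
    · rw [hkj, Equiv.swap_apply_right, hdj, htj, ← hv']
      field_simp
      ring
    rw [hdk hki hkj, htk hki hkj, Equiv.swap_apply_of_ne_of_ne hki hkj, one_mul, add_zero]
  · simp [sub_mul, Finset.sum_sub_distrib, Pi.single_apply, hc]

/-- If `(1 - ζ) * u i` lies in `R`, then `u` lies on the hyperplane of a reflection
multiplying the coordinate `i` by `ζ`. -/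
theorem exists_reflectingHyperplane_diag {r p : ℕ} (hr : r ≠ 0) {R : Subring ℂ}
    (i : Fin n) {ζ : ℂ} (hζ : ζ ^ r = 1) (hζp : ζ ^ (r / p) = 1) (hζ1 : ζ ≠ 1)
    {u : Fin n → ℂ} (hu : (1 - ζ) * u i ∈ R) :
    ∃ H, IsReflectingHyperplane (fun g => IsGrpn r p n g.1 ∧ g.2 ∈ {v | ∀ k, v k ∈ R}) H ∧
      u ∈ H := by
  set c := (1 - ζ) * u i with hc
  have haff (v : Fin n → ℂ) (k : Fin n) :
      applyAff (monomialMatrix 1 (Pi.mulSingle i ζ), Pi.single i c) v k =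
        Pi.mulSingle (M := fun _ => ℂ) i ζ k * v k + Pi.single (M := fun _ => ℂ) i c k := by
    rw [applyAff, Pi.add_apply, monomialMatrix_mulVec, Equiv.Perm.one_apply]
  refine ⟨{v | ∑ k, (Pi.single i 1 : Fin n → ℂ) k * v k = u i},
    ⟨⟨_, fun h => ?_, u i, rfl⟩, (monomialMatrix 1 (Pi.mulSingle i ζ), Pi.single i c),
      ⟨?_, fun k => ?_⟩, ?_, ?_⟩, ?_⟩
  · simpa using congrFun h i
  · refine isGrpn_monomialMatrix hr _ (fun k => ?_) ?_
    · by_cases hki : k = i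
      · rw [hki, Pi.mulSingle_eq_same, hζ]
      · rw [Pi.mulSingle_eq_of_ne hki, one_pow]
    · simpa using hζp
  · by_cases hki : k = i
    · simpa only [hki, Pi.single_eq_same] using hu
    · simpa only [Pi.single_eq_of_ne hki] using zero_mem R
  · refine ⟨Pi.single i (u i + 1), fun h => hζ1 ?_⟩
    have := congrFun h i
    simp only [haff, Pi.mulSingle_eq_same, Pi.single_eq_same] at this
    linear_combination this - hc
  · intro v hv
    have hv' : v i = u i := by simpa [Pi.single_apply] using hv
    ext k
    rw [haff]
    by_cases hki : k = i
    · rw [hki, Pi.mulSingle_eq_same, Pi.single_eq_same, hc, hv']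
      ring
    · rw [Pi.mulSingle_eq_of_ne hki, Pi.single_eq_of_ne hki, one_mul, add_zero]
  · simp [Pi.single_apply]

end Monomial

/-- If `d i ≠ 1`, all `d k` have order dividing `m` and the order of their product is prime to
`m`, then some other `d j` is not `1`. -/
theorem exists_ne_one_of_prod_pow_eq_one {ι M : Type*} [Fintype ι] [CommMonoid M]
    {d : ι → M} {m l : ℕ} (hml : m.Coprime l) (hd : ∀ k, d k ^ m = 1)
    (hprod : (∏ k, d k) ^ l = 1) {i : ι} (hi : d i ≠ 1) : ∃ j, i ≠ j ∧ d j ≠ 1 := by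
  by_contra! hj
  have h1 : ∏ k, d k = d i := Fintype.prod_eq_single i fun k hk => hj k hk.symm
  rw [h1] at hprod
  have := Nat.dvd_gcd (orderOf_dvd_of_pow_eq_one (hd i)) (orderOf_dvd_of_pow_eq_one hprod)
  rw [hml] at this
  exact hi (orderOf_eq_one_iff.1 (Nat.dvd_one.1 this))

/-- Steinberg's theorem for `[G(6,2,n)]₁` and `[G(6,3,n)]₁`, with lattice
`Λ = ℤ[ξ](ξe₁ - e₂) + Σ_{j=2}^n ℤ[ξ](e_{j-1} - e_j)`, where `ξ = e^{2πi/6}`. -/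
theorem steinberg_G_6_p_n_lattice1 (n : ℕ) (hn : 2 ≤ n)
    (ξ : ℂ) (hξ : ξ = Complex.exp (2 * Real.pi * Complex.I / 6))
    (Λ : Set (Fin n → ℂ))
    (hΛ : Λ = {v | ∃ c : Fin n → ℂ, (∀ j, c j ∈ Zlat ξ) ∧ v = ∑ j, c j • genB n ξ j}) :
    ∀ p : ℕ, p = 2 ∨ p = 3 →
      SteinbergProperty (fun g => IsGrpn 6 p n g.1 ∧ g.2 ∈ Λ) := by
  have h := exp_two_pi_I_div_six_sq hξ
  have h6 : ξ ^ 6 = 1 := by linear_combination (ξ ^ 4 + ξ ^ 3 - ξ - 1) * h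
  have hξ3 : ξ ^ 3 = -1 := by linear_combination (ξ + 1) * h
  set R := eisensteinSubring ξ h
  rw [genB_lattice_eq (h := h) hn] at hΛ
  subst hΛ
  rintro p hp u ⟨⟨M, t⟩, ⟨⟨hrow, -, hroot, hprod⟩, ht⟩, hne, hfix⟩
  dsimp only at hrow hroot hprod ht
  have swap {i j : Fin n} (hij : i ≠ j) {ζ : ℂ} (hζ : ζ ^ 6 = 1) (hu : u i - ζ * u j ∈ R) :=
    exists_reflectingHyperplane_swap (p := p) (by norm_num) hij hζ
      (sixth_root_mem (by rw [inv_pow, hζ, inv_one])) hu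
  have hval (i j) (hij : M i j ≠ 0) : M i j * u j + t i = u i := by
    rw [← applyAff_apply_of_row (fun k hk => not_not.1 (mt ((hrow i).unique · hij) hk)), hfix]
  by_cases hoff : ∃ i j, i ≠ j ∧ M i j ≠ 0
  · obtain ⟨i, j, hij, hMij⟩ := hoff
    refine swap hij (hroot i j hMij) ?_
    rw [show u i - M i j * u j = t i by linear_combination -hval i j hMij]
    exact ht i
  push Not at hoff
  have hdiag (i) : M i i ≠ 0 := by
    obtain ⟨j, hj, -⟩ := hrow i
    by_cases hij : i = j
    · rwa [← hij] at hj
    · exact absurd (hoff i j hij) hj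
  have hsum (i) : ∑ j, M i j = M i i := Finset.sum_eq_single i
    (fun j _ hj => hoff i j hj.symm) (by simp)
  simp only [hsum] at hprod
  have hmem (i) : (1 - M i i) * u i ∈ R := by
    rw [show (1 - M i i) * u i = t i by linear_combination -hval i i (hdiag i)]
    exact ht i
  have hroot' (i) : M i i ^ 6 = 1 := hroot i i (hdiag i)
  obtain ⟨i, hi⟩ : ∃ i, M i i ≠ 1 := by
    by_contra! h1
    obtain ⟨v, hv⟩ := hne
    refine hv (funext fun i => ?_)
    have hti : t i = 0 := by linear_combination hval i i (hdiag i) - u i * h1 i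
    rw [applyAff_apply_of_row (fun j hj => hoff i j hj.symm), h1, hti, one_mul, add_zero]
  have hm1 : (-1 : ℂ) ≠ 1 := by norm_num
  have hnξ : -ξ ≠ 1 := fun h' => by
    have : (3 : ℂ) = 0 := by linear_combination (ξ - 2) * h' + h
    norm_num at this
  rcases hp with rfl | rfl
  · have diag (i : Fin n) {ζ : ℂ} (hζ : ζ ^ 3 = 1) (hζ1 : ζ ≠ 1) (hu : (1 - ζ) * u i ∈ R) :=
      exists_reflectingHyperplane_diag (r := 6) (p := 2) (by norm_num) i
        (by linear_combination (ζ ^ 3 + 1) * hζ) hζ hζ1 hu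
    have of_mem (i : Fin n) (hu : u i ∈ R) :=
      diag i (ζ := -ξ) (by linear_combination -hξ3) hnξ
        (mul_mem (sub_mem (one_mem R) (neg_mem generator_mem)) hu)
    by_cases hsq : ∀ k, M k k = 1 ∨ M k k = -1
    · obtain ⟨j, hij, hj⟩ := exists_ne_one_of_prod_pow_eq_one (m := 2) (by norm_num)
        (fun k => by rcases hsq k with h' | h' <;> simp [h']) hprod hi
      have htwo (k) (hk : M k k ≠ 1) : 2 * u k ∈ R := by
        have := hmem k
        rwa [(hsq k).resolve_left hk, sub_neg_eq_add, one_add_one_eq_two] at this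
      rcases half_mem_or_exists_sub_mul_mem (htwo i hi) (htwo j hj) with hu | hu | ⟨ζ, hζ, hu⟩
      · exact of_mem i hu
      · exact of_mem j hu
      · exact swap hij hζ hu
    · push Not at hsq
      obtain ⟨k, hk1, hk2⟩ := hsq
      rcases sixth_root_cases (hroot' k) with h' | h' | h' | h'
      · exact absurd h' hk1
      · exact absurd h' hk2
      · exact diag k (by linear_combination (M k k - 1) * h') hk1 (hmem k)
      · exact of_mem k (mem_of_one_sub_mul_mem h' (hmem k))
  · have diag (i : Fin n) (hu : (1 - -1) * u i ∈ R) :=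
      exists_reflectingHyperplane_diag (r := 6) (p := 3) (by norm_num) i
        (by norm_num) (by norm_num) hm1 hu
    have of_mem (i : Fin n) (hu : u i ∈ R) :=
      diag i (mul_mem (sub_mem (one_mem R) (neg_mem (one_mem R))) hu)
    by_cases hcube : ∀ k, M k k = 1 ∨ M k k ^ 2 + M k k + 1 = 0
    · obtain ⟨j, hij, hj⟩ := exists_ne_one_of_prod_pow_eq_one (m := 3) (by norm_num)
        (fun k => by
          rcases hcube k with h' | h'
          · rw [h', one_pow]
          · linear_combination (M k k - 1) * h') hprod hi
      have hthird (k) (hk : M k k ≠ 1) : (1 + ξ) * u k ∈ R :=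
        one_add_mul_mem ((hcube k).resolve_left hk) (hmem k)
      rcases third_mem_or_exists_sub_mul_mem (hthird i hi) (hthird j hj) with
        hu | hu | ⟨ζ, hζ, hu⟩
      · exact of_mem i hu
      · exact of_mem j hu
      · exact swap hij hζ hu
    · push Not at hcube
      obtain ⟨k, hk1, hk3⟩ := hcube
      rcases sixth_root_cases (hroot' k) with h' | h' | h' | h'
      · exact absurd h' hk1
      · exact diag k (h' ▸ hmem k)
      · exact absurd h' hk3
      · exact of_mem k (mem_of_one_sub_mul_mem h' (hmem k))
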